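/- arXiv:1011.1773 — 3 statements merged into one kernel-verified Lean document; each statement's English description precedes it below -/
import Mathlib

section
/- Assume 2/3 < φ < φ₂, where φ₂ := 2(1+ρ)(1+ρ²)/(3(1+ρ)(1+ρ²) − (1−ρ)S). Then for every x = (x₀, x₁, x₂) ∈ Δ with x₀ < π₀, the following are equivalent: (a) for every integer n ≥ 1, (x·P_B^n)₀ < π₀; (b) (1 + S/(1+ρ²))(x₀ − π₀) + 2(x₁ − π₁) = 0. -/
open Matrix Filter

/-- Game A's one-step transition matrix (fully mixing). -/
noncomputable def PAo : Matrix (Fin 3) (Fin 3) ℝ :=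
  !![0, 1/2, 1/2; 1/2, 0, 1/2; 1/2, 1/2, 0]

/-- Game B's one-step transition matrix. -/
noncomputable def PBo (ρ : ℝ) : Matrix (Fin 3) (Fin 3) ℝ :=
  !![0, ρ^2/(1+ρ^2), 1 - ρ^2/(1+ρ^2);
     1 - 1/(1+ρ), 0, 1/(1+ρ);
     1/(1+ρ), 1 - 1/(1+ρ), 0]

/-- Transition matrix when a fraction φ of the players plays game A. -/
noncomputable def PA (φ : ℝ) : Matrix (Fin 3) (Fin 3) ℝ :=
  (1 - φ) • (1 : Matrix (Fin 3) (Fin 3) ℝ) + φ • PAo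

/-- Transition matrix when a fraction φ of the players plays game B. -/
noncomputable def PB (ρ φ : ℝ) : Matrix (Fin 3) (Fin 3) ℝ :=
  (1 - φ) • (1 : Matrix (Fin 3) (Fin 3) ℝ) + φ • PBo ρ

/-- The simplex of probability row vectors in ℝ³. -/
def Δ : Set (Fin 3 → ℝ) := {x | (∀ i, 0 ≤ x i) ∧ x 0 + x 1 + x 2 = 1}

noncomputable def pi0 (ρ : ℝ) : ℝ := (1 + ρ^2) / (2 * (1 + ρ + ρ^2))
noncomputable def pi1 (ρ : ℝ) : ℝ := ρ * (1 + ρ) / (2 * (1 + ρ + ρ^2))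
noncomputable def pi2 (ρ : ℝ) : ℝ := (1 + ρ) / (2 * (1 + ρ + ρ^2))

noncomputable def Sv (ρ : ℝ) : ℝ := Real.sqrt ((1 + ρ^2) * (1 + 4*ρ + ρ^2))

noncomputable def e1 (ρ φ : ℝ) : ℝ :=
  1 - φ + φ * (-(1/2) + (1 - ρ) * Sv ρ / (2 * (1 + ρ) * (1 + ρ^2)))

noncomputable def e2 (ρ φ : ℝ) : ℝ :=
  1 - φ + φ * (-(1/2) - (1 - ρ) * Sv ρ / (2 * (1 + ρ) * (1 + ρ^2)))

/-- `Emn ρ φ n m` is the quantity `E_{n,m}`; `E_n = Emn ρ φ n n`. -/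
noncomputable def Emn (ρ φ : ℝ) (n m : ℕ) : ℝ :=
  φ * (1 - ρ) / 2 *
    ((e2 ρ φ)^m * (2 + (e1 ρ φ)^n * (3*φ - 2)) * (3*(1+ρ)*(1+ρ^2) - (1-ρ) * Sv ρ)
      - (e1 ρ φ)^m * (2 + (e2 ρ φ)^n * (3*φ - 2)) * (3*(1+ρ)*(1+ρ^2) + (1-ρ) * Sv ρ))

/-- `Dn ρ φ n` is the quantity `D_n`. -/
noncomputable def Dn (ρ φ : ℝ) (n : ℕ) : ℝ :=
  2 * (2 + (e1 ρ φ)^n * (3*φ - 2)) * (2 + (e2 ρ φ)^n * (3*φ - 2)) * (1 + ρ + ρ^2) * Sv ρ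

/-- `Gmn ρ φ n m` is the quantity `G_{n,m}`. -/
noncomputable def Gmn (ρ φ : ℝ) (n m : ℕ) : ℝ :=
  φ * (1 - ρ) *
    ((e2 ρ φ)^m * (4 - (e1 ρ φ)^(2*(n-1)) * (3*φ - 2)^2) * (2 - (e2 ρ φ)^(n-2) * (3*φ - 2))
        * (3*(1+ρ)*(1+ρ^2) - (1-ρ) * Sv ρ)
      - (e1 ρ φ)^m * (4 - (e2 ρ φ)^(2*(n-1)) * (3*φ - 2)^2) * (2 - (e1 ρ φ)^(n-2) * (3*φ - 2))
        * (3*(1+ρ)*(1+ρ^2) + (1-ρ) * Sv ρ))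

/-- `Hmn ρ φ n m` is the quantity `H_{n,m}`. -/
noncomputable def Hmn (ρ φ : ℝ) (n m : ℕ) : ℝ :=
  φ * (1 - ρ) *
    ((e2 ρ φ)^m * (4 - (e1 ρ φ)^(2*(n-1)) * (3*φ - 2)^2) * (2 - (e2 ρ φ)^n * (3*φ - 2))
        * (3*(1+ρ)*(1+ρ^2) - (1-ρ) * Sv ρ)
      - (e1 ρ φ)^m * (4 - (e2 ρ φ)^(2*(n-1)) * (3*φ - 2)^2) * (2 - (e1 ρ φ)^n * (3*φ - 2))
        * (3*(1+ρ)*(1+ρ^2) + (1-ρ) * Sv ρ))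

lemma growth_aux (e r c M : ℝ) (he : 0 < e) (hr : e < r) (hc : 0 < c) :
    ∃ N : ℕ, ∀ n : ℕ, N ≤ n → e ^ n * M ≤ r ^ n * c := by
  have h1 : 1 < r / e := by rw [lt_div_iff₀ he]; linarith
  obtain ⟨N, hN⟩ := pow_unbounded_of_one_lt (M / c) h1
  refine ⟨N, fun n hn => ?_⟩
  have h2 : M / c < (r / e) ^ n := lt_of_lt_of_le hN (pow_le_pow_right₀ h1.le hn)
  rw [div_pow, div_lt_div_iff₀ hc (by positivity)] at h2
  linarith

lemma sign_aux (e r L M : ℝ) (he : 0 < e) (hr : e < r)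
    (h : ∀ n : ℕ, 1 ≤ n → (-r) ^ n * L < e ^ n * M) : L = 0 := by
  rcases lt_trichotomy L 0 with hL | hL | hL
  · obtain ⟨N, hN⟩ := growth_aux e r (-L) M he hr (by linarith)
    have h1 := hN (2 * N + 1) (by omega)
    have h2 := h (2 * N + 1) (by omega)
    rw [Odd.neg_pow ⟨N, rfl⟩] at h2
    linarith
  · exact hL
  · obtain ⟨N, hN⟩ := growth_aux e r L M he hr hL
    have h1 := hN (2 * (N + 1)) (by omega)
    have h2 := h (2 * (N + 1)) (by omega)
    rw [Even.neg_pow (even_two_mul _)] at h2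
    linarith

lemma step_aux (ρ φ : ℝ) (y : Fin 3 → ℝ) :
    (y ᵥ* PB ρ φ) 0 = (1 - φ) * y 0 + φ * (y 1 * (1 - 1/(1+ρ)) + y 2 * (1/(1+ρ))) ∧
    (y ᵥ* PB ρ φ) 1 = (1 - φ) * y 1 + φ * (y 0 * (ρ^2/(1+ρ^2)) + y 2 * (1 - 1/(1+ρ))) ∧
    (y ᵥ* PB ρ φ) 2 = (1 - φ) * y 2 + φ * (y 0 * (1 - ρ^2/(1+ρ^2)) + y 1 * (1/(1+ρ))) := by
  refine ⟨?_, ?_, ?_⟩ <;>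
  · simp [Matrix.vecMul, dotProduct, Fin.sum_univ_three, PB, PBo, Matrix.one_apply]
    ring

lemma lin_aux (ρ φ s : ℝ) (hρ0 : 0 < ρ) (hs : s ^ 2 * (1 + ρ^2) = 1 + 4*ρ + ρ^2)
    (a b c a' b' : ℝ) (h1 : a + b + c = 1)
    (ha : a' = (1 - φ) * a + φ * (b * (1 - 1/(1+ρ)) + c * (1/(1+ρ))))
    (hb : b' = (1 - φ) * b + φ * (a * (ρ^2/(1+ρ^2)) + c * (1 - 1/(1+ρ)))) :
    (1 + s) * (a' - pi0 ρ) + 2 * (b' - pi1 ρ) =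
      (1 - φ + φ * (-(1/2) - (1 - ρ) * s / (2 * (1 + ρ)))) *
        ((1 + s) * (a - pi0 ρ) + 2 * (b - pi1 ρ)) := by
  have e1 : (1 + ρ) ≠ 0 := by positivity
  have e2 : (1 + ρ^2) ≠ 0 := by positivity
  have e3 : (1 + ρ + ρ^2) ≠ 0 := by positivity
  have hs' : s ^ 2 = (1 + 4*ρ + ρ^2) / (1 + ρ^2) := by field_simp; linarith
  have hc : c = 1 - a - b := by linarith
  have key : (1 + s) * (a' - pi0 ρ) + 2 * (b' - pi1 ρ) -
      (1 - φ + φ * (-(1/2) - (1 - ρ) * s / (2 * (1 + ρ)))) *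
        ((1 + s) * (a - pi0 ρ) + 2 * (b - pi1 ρ)) =
      φ * (1 - ρ) / (2 * (1 + ρ)) * (a - pi0 ρ) * (s ^ 2 - (1 + 4*ρ + ρ^2) / (1 + ρ^2)) := by
    subst ha hb hc
    unfold pi0 pi1
    field_simp
    ring
  rw [hs', sub_self, mul_zero] at key
  linarith

theorem stmt_10 (ρ φ : ℝ) (hρ0 : 0 < ρ) (hρ1 : ρ < 1) (hφ0 : 2/3 < φ)
    (hφ1 : φ < 2*(1+ρ)*(1+ρ^2) / (3*(1+ρ)*(1+ρ^2) - (1-ρ) * Sv ρ))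
    (x : Fin 3 → ℝ) (hx : x ∈ Δ) (hx0 : x 0 < pi0 ρ) :
    (∀ n : ℕ, 1 ≤ n → (x ᵥ* ((PB ρ φ) ^ n)) 0 < pi0 ρ) ↔
    (1 + Sv ρ / (1 + ρ^2)) * (x 0 - pi0 ρ) + 2 * (x 1 - pi1 ρ) = 0 := by
  have hT : 0 < (1 + ρ^2) := by positivity
  have hT1 : 0 < (1 + ρ) := by positivity
  obtain ⟨s, hsdef⟩ : ∃ s, s = Sv ρ / (1 + ρ^2) := ⟨_, rfl⟩
  have hSpos : 0 < Sv ρ := Real.sqrt_pos.mpr (by positivity)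
  have hspos : 0 < s := by rw [hsdef]; positivity
  have hS : Sv ρ = s * (1 + ρ^2) := by rw [hsdef]; field_simp
  have hSsq : Sv ρ ^ 2 = (1 + ρ^2) * (1 + 4*ρ + ρ^2) := Real.sq_sqrt (by positivity)
  have hs : s ^ 2 * (1 + ρ^2) = 1 + 4*ρ + ρ^2 := by
    rw [hsdef, div_pow, hSsq]; field_simp
  rw [← hsdef]
  -- `(1 - ρ) s < 1 + ρ`
  have hlt : (1 - ρ) * s < 1 + ρ := by
    apply lt_of_pow_lt_pow_left₀ 2 hT1.le
    have h3 : ((1 - ρ) * s) ^ 2 * (1 + ρ^2) < (1 + ρ) ^ 2 * (1 + ρ^2) := by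
      have : ((1 - ρ) * s) ^ 2 * (1 + ρ^2) = (1 - ρ)^2 * (1 + 4*ρ + ρ^2) := by
        rw [← hs]; ring
      rw [this]; nlinarith [pow_pos hρ0 2]
    exact lt_of_mul_lt_mul_right h3 hT.le
  have hφ : φ * (3 * (1 + ρ) - (1 - ρ) * s) < 2 * (1 + ρ) := by
    rw [hS, lt_div_iff₀ (by nlinarith)] at hφ1
    have : (φ * (3 * (1 + ρ) - (1 - ρ) * s)) * (1 + ρ^2) < (2 * (1 + ρ)) * (1 + ρ^2) := by
      linarith
    exact lt_of_mul_lt_mul_right this hT.le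
  obtain ⟨q, hq⟩ : ∃ q, q = (1 - ρ) * s / (2 * (1 + ρ)) := ⟨_, rfl⟩
  have hqe : (1 - ρ) * s = q * (2 * (1 + ρ)) := by rw [hq]; field_simp
  have he : 0 < 1 - φ + φ * (-(1/2) + q) := by
    rw [hqe] at hφ
    have : (φ * (3 - 2 * q)) * (1 + ρ) < 2 * (1 + ρ) := by linarith
    have := lt_of_mul_lt_mul_right this hT1.le
    linarith
  have her : 1 - φ + φ * (-(1/2) + q) < -(1 - φ + φ * (-(1/2) - q)) := by linarith
  have hrec : ∀ n : ℕ, (x ᵥ* PB ρ φ ^ n) 0 + (x ᵥ* PB ρ φ ^ n) 1 + (x ᵥ* PB ρ φ ^ n) 2 = 1 ∧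
      (1 + s) * ((x ᵥ* PB ρ φ ^ n) 0 - pi0 ρ) + 2 * ((x ᵥ* PB ρ φ ^ n) 1 - pi1 ρ) =
        (1 - φ + φ * (-(1/2) - q)) ^ n * ((1 + s) * (x 0 - pi0 ρ) + 2 * (x 1 - pi1 ρ)) ∧
      (1 - s) * ((x ᵥ* PB ρ φ ^ n) 0 - pi0 ρ) + 2 * ((x ᵥ* PB ρ φ ^ n) 1 - pi1 ρ) =
        (1 - φ + φ * (-(1/2) + q)) ^ n * ((1 - s) * (x 0 - pi0 ρ) + 2 * (x 1 - pi1 ρ)) := by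
    intro n
    induction n with
    | zero => simpa using hx.2
    | succ n ih =>
      rw [pow_succ, ← Matrix.vecMul_vecMul]
      generalize x ᵥ* PB ρ φ ^ n = y at ih
      obtain ⟨i1, i2, i3⟩ := ih
      obtain ⟨s0, s1, s2⟩ := step_aux ρ φ y
      refine ⟨?_, ?_, ?_⟩
      · rw [s0, s1, s2]; linear_combination i1
      · rw [lin_aux ρ φ s hρ0 hs _ _ _ _ _ i1 s0 s1, i2, hq]; ring
      · have := lin_aux ρ φ (-s) hρ0 (by rw [neg_sq]; exact hs) _ _ _ _ _ i1 s0 s1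
        rw [← sub_eq_add_neg] at this
        rw [this, i3, hq]; ring
  obtain ⟨L, hL⟩ : ∃ L, L = (1 + s) * (x 0 - pi0 ρ) + 2 * (x 1 - pi1 ρ) := ⟨_, rfl⟩
  obtain ⟨M, hM⟩ : ∃ M, M = (1 - s) * (x 0 - pi0 ρ) + 2 * (x 1 - pi1 ρ) := ⟨_, rfl⟩
  rw [← hL, ← hM] at hrec
  rw [← hL]
  constructor
  · intro h
    refine sign_aux _ _ L M he her fun n hn => ?_
    obtain ⟨-, i2, i3⟩ := hrec n
    rw [neg_neg, ← i2, ← i3]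
    nlinarith [mul_pos hspos (sub_pos.mpr (h n hn))]
  · intro h0 n hn
    obtain ⟨-, i2, i3⟩ := hrec n
    have hMpos : 0 < M := by nlinarith [mul_pos hspos (sub_pos.mpr hx0)]
    have h5 := mul_pos (pow_pos he n) hMpos
    rw [← i3] at h5
    rw [h0, mul_zero] at i2
    have h6 : 0 < s * (pi0 ρ - (x ᵥ* PB ρ φ ^ n) 0) := by linarith
    have := (mul_pos_iff_of_pos_left hspos).mp h6
    linarith
end

section
/- Assume 2/3 < φ ≤ 1, let n ≥ 2 be an even integer, and let v be a probability row vector (v ∈ Δ) satisfying v·(P_A·P_B^n) = v. Then the following are equivalent: (a) v₀ ≥ π₀ and (v·P_A·P_B^m)₀ < π₀ for every integer m with 0 ≤ m ≤ n−1 (i.e., the greedy strategy started at v follows the periodic pattern [1,n]: one play of game A followed by n plays of game B, repeated forever); (b) Eₙ ≥ 0, and either n = 2 or E_{n,n−2} < 0. -/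
open Matrix Filter

/-- The normalized gap between the eigenvalues. -/
noncomputable def cc (ρ : ℝ) : ℝ := (1 - ρ) * Sv ρ / (2 * (1 + ρ) * (1 + ρ^2))

/-- Right eigenvector of `PB`. -/
noncomputable def sv (ρ z : ℝ) : Fin 3 → ℝ :=
  ![1/2 + z - (3/2 + z) * pi0 ρ, ρ/(1+ρ) - (3/2 + z) * pi0 ρ, 1/(1+ρ) - (3/2 + z) * pi0 ρ]

lemma Sv_sq (ρ : ℝ) (h : 0 < ρ) : Sv ρ ^ 2 = (1 + ρ^2) * (1 + 4*ρ + ρ^2) := by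
  unfold Sv
  exact Real.sq_sqrt (by positivity)

lemma cc_sq (ρ : ℝ) (h : 0 < ρ) :
    cc ρ ^ 2 * (4 * (1+ρ)^2 * (1+ρ^2)) = (1-ρ)^2 * (1+4*ρ+ρ^2) := by
  have h1 := Sv_sq ρ h
  unfold cc
  rw [div_pow, mul_pow, h1]
  field_simp
  ring

lemma cc_pos (ρ : ℝ) (h : 0 < ρ) (h1 : ρ < 1) : 0 < cc ρ := by
  have : 0 < Sv ρ := Real.sqrt_pos.mpr (by positivity)
  have : 0 < 1 - ρ := by linarith
  unfold cc
  positivity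

lemma cc_lt (ρ : ℝ) (h : 0 < ρ) (h1 : ρ < 1) : cc ρ < 1/2 := by
  have h2 := cc_sq ρ h
  have h3 := cc_pos ρ h h1
  by_contra hc
  push Not at hc
  have h4 : (1/4:ℝ) ≤ cc ρ ^ 2 := by nlinarith
  have h5 : (1/4:ℝ) * (4 * (1+ρ)^2 * (1+ρ^2)) ≤ cc ρ ^ 2 * (4 * (1+ρ)^2 * (1+ρ^2)) :=
    mul_le_mul_of_nonneg_right h4 (by positivity)
  nlinarith [sq_nonneg ρ, mul_pos h h]

lemma eig (ρ φ z : ℝ) (h : 0 < ρ)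
    (hz : z ^ 2 * (4 * (1+ρ)^2 * (1+ρ^2)) = (1-ρ)^2 * (1+4*ρ+ρ^2)) :
    PB ρ φ *ᵥ sv ρ z = (1 - φ + φ * (-(1/2) + z)) • sv ρ z := by
  have hz2 : z ^ 2 = (1-ρ)^2 * (1+4*ρ+ρ^2) / (4 * (1+ρ)^2 * (1+ρ^2)) := by
    rw [eq_div_iff (by positivity)]; exact hz
  have ho : PBo ρ *ᵥ sv ρ z = (-(1/2) + z) • sv ρ z := by
    have hq : (1 + ρ + ρ^2) ≠ 0 := by positivity
    ext i
    fin_cases i <;>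
    simp [PBo, sv, pi0, Matrix.mulVec, dotProduct, Fin.sum_univ_three]
    · rw [← sub_eq_zero]
      have : ∀ a b : ℝ, a = b → b = 0 → a = 0 := by intro a b h1 h2; rw [h1, h2]
      apply this _ ((z ^ 2 - (1-ρ)^2 * (1+4*ρ+ρ^2) / (4 * (1+ρ)^2 * (1+ρ^2))) * (pi0 ρ - 1))
      · unfold pi0; field_simp; ring
      · rw [hz2]; ring
    · rw [← sub_eq_zero]
      have : ∀ a b : ℝ, a = b → b = 0 → a = 0 := by intro a b h1 h2; rw [h1, h2]
      apply this _ ((z ^ 2 - (1-ρ)^2 * (1+4*ρ+ρ^2) / (4 * (1+ρ)^2 * (1+ρ^2))) * (pi0 ρ))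
      · unfold pi0; field_simp; ring
      · rw [hz2]; ring
    · rw [← sub_eq_zero]
      have : ∀ a b : ℝ, a = b → b = 0 → a = 0 := by intro a b h1 h2; rw [h1, h2]
      apply this _ ((z ^ 2 - (1-ρ)^2 * (1+4*ρ+ρ^2) / (4 * (1+ρ)^2 * (1+ρ^2))) * (pi0 ρ))
      · unfold pi0; field_simp; ring
      · rw [hz2]; ring
  unfold PB
  rw [Matrix.add_mulVec, Matrix.smul_mulVec, Matrix.smul_mulVec, ho, Matrix.one_mulVec,
    smul_smul, ← add_smul]

lemma pow_eig (M : Matrix (Fin 3) (Fin 3) ℝ) (r : Fin 3 → ℝ) (l : ℝ) (h : M *ᵥ r = l • r)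
    (m : ℕ) : (M ^ m) *ᵥ r = (l ^ m) • r := by
  induction m with
  | zero => simp
  | succ k ih =>
    rw [pow_succ, ← Matrix.mulVec_mulVec, h, Matrix.mulVec_smul, ih, smul_smul, pow_succ, mul_comm]

lemma PB_one (ρ φ : ℝ) : PB ρ φ *ᵥ (fun _ => (1:ℝ)) = (1:ℝ) • (fun _ => (1:ℝ)) := by
  ext i
  fin_cases i <;>
  simp [PB, PBo, Matrix.mulVec, dotProduct, Fin.sum_univ_three, Matrix.one_apply] <;> ring

lemma pa_dot (φ : ℝ) (v r : Fin 3 → ℝ) (hv : v 0 + v 1 + v 2 = 1) :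
    (v ᵥ* PA φ) ⬝ᵥ r = (1 - 3*φ/2) * (v ⬝ᵥ r) + φ/2 * (r 0 + r 1 + r 2) := by
  simp [PA, PAo, Matrix.vecMul, dotProduct, Fin.sum_univ_three, Matrix.one_apply]
  linear_combination (φ/2 * (r 0 + r 1 + r 2)) * hv

lemma key (ρ φ : ℝ) (hρ0 : 0 < ρ) (hρ1 : ρ < 1)
    (n : ℕ) (v : Fin 3 → ℝ) (hv : v ∈ Δ)
    (hfix : v ᵥ* (PA φ * (PB ρ φ) ^ n) = v) (m : ℕ) :
    8 * cc ρ * (1 - ρ) * ((1 + ρ) * (1 + ρ^2)) * (1 + (3*φ/2-1) * (e1 ρ φ)^n)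
      * (1 + (3*φ/2-1) * (e2 ρ φ)^n)
      * (((v ᵥ* PA φ) ᵥ* ((PB ρ φ) ^ m)) 0 - pi0 ρ)
    = (3 * pi0 ρ - 1) * Emn ρ φ n m := by
  have hv1 := hv.2
  have he1 : e1 ρ φ = 1 - φ + φ * (-(1/2) + cc ρ) := rfl
  have he2 : e2 ρ φ = 1 - φ + φ * (-(1/2) + -cc ρ) := by unfold e2 cc; ring
  have g1 := eig ρ φ (cc ρ) hρ0 (cc_sq ρ hρ0)
  have g2 := eig ρ φ (-cc ρ) hρ0 (by rw [neg_sq]; exact cc_sq ρ hρ0)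
  rw [← he1] at g1
  rw [← he2] at g2
  set y := v ᵥ* PA φ with hy
  have hyn : y ᵥ* (PB ρ φ) ^ n = v := by rw [hy, Matrix.vecMul_vecMul]; exact hfix
  have hpow : ∀ (k : ℕ) (r : Fin 3 → ℝ) (l : ℝ), PB ρ φ *ᵥ r = l • r →
      (y ᵥ* (PB ρ φ) ^ k) ⬝ᵥ r = l ^ k * (y ⬝ᵥ r) := by
    intro k r l hr
    rw [← Matrix.dotProduct_mulVec, pow_eig _ _ _ hr, dotProduct_smul, smul_eq_mul]
  have hsum : ∀ z, sv ρ z 0 + sv ρ z 1 + sv ρ z 2 = (3/2 + z) * (1 - 3 * pi0 ρ) := by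
    intro z
    have : ρ/(1+ρ) + 1/(1+ρ) = 1 := by field_simp; ring
    simp [sv] at this ⊢
    linear_combination this
  have Y1 : (y ⬝ᵥ sv ρ (cc ρ)) * (1 + (3*φ/2-1) * (e1 ρ φ)^n)
      = φ/2 * ((3/2 + cc ρ) * (1 - 3 * pi0 ρ)) := by
    have a1 := pa_dot φ v (sv ρ (cc ρ)) hv1
    have a2 := hpow n _ _ g1
    rw [hyn] at a2
    rw [← hy, a2, hsum] at a1
    linear_combination a1
  have Y2 : (y ⬝ᵥ sv ρ (-cc ρ)) * (1 + (3*φ/2-1) * (e2 ρ φ)^n)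
      = φ/2 * ((3/2 + -cc ρ) * (1 - 3 * pi0 ρ)) := by
    have a1 := pa_dot φ v (sv ρ (-cc ρ)) hv1
    have a2 := hpow n _ _ g2
    rw [hyn] at a2
    rw [← hy, a2, hsum] at a1
    linear_combination a1
  have one0 : y ⬝ᵥ (fun _ => (1:ℝ)) = 1 := by
    rw [hy, pa_dot φ v _ hv1]
    simp only [dotProduct, Fin.sum_univ_three]
    linear_combination (1 - 3*φ/2) * hv1
  have onem := hpow m _ _ (PB_one ρ φ)
  rw [one0] at onem
  have b1 := hpow m _ _ g1
  have b2 := hpow m _ _ g2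
  set x := y ᵥ* (PB ρ φ) ^ m with hx
  have hX : 2 * cc ρ * (x 0 - pi0 ρ) = e1 ρ φ ^ m * (y ⬝ᵥ sv ρ (cc ρ))
      - e2 ρ φ ^ m * (y ⬝ᵥ sv ρ (-cc ρ)) := by
    rw [← b1, ← b2]
    simp [sv, dotProduct, Fin.sum_univ_three] at onem ⊢
    linear_combination (2 * cc ρ * pi0 ρ) * onem
  have hB : (1 - ρ) * Sv ρ = 2 * cc ρ * ((1 + ρ) * (1 + ρ^2)) := by
    unfold cc; field_simp
  unfold Emn
  rw [hB]
  linear_combination (4 * (1 - ρ) * ((1 + ρ) * (1 + ρ^2)) * (1 + (3*φ/2-1) * (e1 ρ φ)^n)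
      * (1 + (3*φ/2-1) * (e2 ρ φ)^n)) * hX
    + 4 * (1 - ρ) * ((1 + ρ) * (1 + ρ^2)) * (1 + (3*φ/2-1) * (e2 ρ φ)^n) * e1 ρ φ ^ m * Y1
    - 4 * (1 - ρ) * ((1 + ρ) * (1 + ρ^2)) * (1 + (3*φ/2-1) * (e1 ρ φ)^n) * e2 ρ φ ^ m * Y2

lemma pow_diff (a b : ℝ) (hb : 0 ≤ b) (hab : b ≤ a) (h1 : a + b ≤ 1) (n : ℕ) :
    a * (a^n - b^n) ≤ a - b := by
  induction n with
  | zero => simpa using hab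
  | succ k ih =>
    have hk : a^k * a ≤ a := by
      have : a^k ≤ 1 := pow_le_one₀ (by linarith) (by linarith)
      nlinarith
    have e : a * (a^(k+1) - b^(k+1)) = (a^k * a) * (a - b) + b * (a * (a^k - b^k)) := by ring
    rw [e]
    have h2 : (a^k * a) * (a - b) ≤ a * (a - b) := mul_le_mul_of_nonneg_right hk (by linarith)
    have h3 : b * (a * (a^k - b^k)) ≤ b * (a - b) := mul_le_mul_of_nonneg_left ih hb
    nlinarith

/-- The inequality behind `E_{n,1} < 0`. -/
lemma odd_key (t u : ℝ) (hu : 0 < u) (hut : u < t) (ht : t ≤ 1/2) (n : ℕ) (hn : 1 ≤ n) :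
    (1 + t * (t+u)^n) * (t+1+u) * (t-u) < (1 + t * (t-u)^n) * (t+1-u) * (t+u) := by
  obtain ⟨k, rfl⟩ : ∃ k, n = k + 1 := ⟨n - 1, by omega⟩
  obtain ⟨a, ha⟩ : ∃ a, a = t + u := ⟨_, rfl⟩
  obtain ⟨b, hb⟩ : ∃ b, b = t - u := ⟨_, rfl⟩
  have hb0 : 0 < b := by linarith
  have p1 := pow_diff a b hb0.le (by linarith) (by linarith) k
  have p2 := pow_diff a b hb0.le (by linarith) (by linarith) (k+1)
  have q : (t * b) * (a * (a^k - b^k) + a * (a^(k+1) - b^(k+1))) ≤ (t*b) * (2 * (a - b)) :=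
    mul_le_mul_of_nonneg_left (by linarith) (by nlinarith)
  have htb : t * b < 1/4 := by nlinarith
  have q2 : (t*b) * (2 * (a - b)) < a - b := by nlinarith
  have e1 : t + 1 + u = 1 + a := by linarith
  have e2 : t + 1 - u = 1 + b := by linarith
  rw [e1, e2, ← ha, ← hb]
  have : (1 + t * b^(k+1)) * (1+b) * a - (1 + t * a^(k+1)) * (1+a) * b
    = (a - b) - (t * b) * (a * (a^k - b^k) + a * (a^(k+1) - b^(k+1))) := by ring
  linarith

/-- Sign pattern of `α x^m - β z^m`. -/
lemma stmt_odd_case (α β x z : ℝ) (hα : 0 < α) (hβ : 0 < β) (hx : x < 0) (hxz : z^2 ≤ x^2)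
    (h1 : α * x - β * z < 0) (j : ℕ) : α * x^(2*j+1) - β * z^(2*j+1) < 0 := by
  have hp : (0:ℝ) < (x^2)^j := pow_pos (by nlinarith) j
  have hq0 : (0:ℝ) ≤ (z^2)^j := by positivity
  have hq : (z^2)^j ≤ (x^2)^j := pow_le_pow_left₀ (sq_nonneg z) hxz j
  rw [pow_succ, pow_succ, pow_mul, pow_mul]
  generalize (x^2)^j = p at *
  generalize (z^2)^j = q at *
  rcases le_or_gt 0 z with hz | hz
  · have : 0 ≤ β * (q * z) := by positivity
    have : 0 < α * (p * (-x)) := mul_pos hα (mul_pos hp (by linarith))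
    linarith
  · have : 0 ≤ β * ((p - q) * (-z)) := by
      apply mul_nonneg hβ.le (mul_nonneg (by linarith) (by linarith))
    have : 0 < p * (-(α * x - β * z)) := mul_pos hp (by linarith)
    nlinarith

lemma stmt_even_case (α β x z : ℝ) (hα : 0 < α) (hβ : 0 < β) (hxz : z^2 ≤ x^2)
    (i d : ℕ) (h1 : α * x^(2*(i+d)) - β * z^(2*(i+d)) < 0) : α * x^(2*i) - β * z^(2*i) < 0 := by
  by_contra hc
  push Not at hc
  rw [pow_mul, pow_mul] at h1 hc
  rw [pow_add, pow_add] at h1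
  have hp : (0:ℝ) ≤ (x^2)^d := by positivity
  have hq0 : (0:ℝ) ≤ (z^2)^i := by positivity
  have hq : (z^2)^d ≤ (x^2)^d := pow_le_pow_left₀ (sq_nonneg z) hxz d
  have h2 := mul_nonneg hc hp
  have h3 : 0 ≤ β * (z^2)^i * ((x^2)^d - (z^2)^d) :=
    mul_nonneg (mul_nonneg hβ.le hq0) (by linarith)
  nlinarith

theorem stmt_14 (ρ φ : ℝ) (hρ0 : 0 < ρ) (hρ1 : ρ < 1) (hφ0 : 2/3 < φ) (hφ1 : φ ≤ 1)
    (n : ℕ) (hn : 2 ≤ n) (hne : Even n) (v : Fin 3 → ℝ) (hv : v ∈ Δ)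
    (hfix : v ᵥ* (PA φ * (PB ρ φ) ^ n) = v) :
    (pi0 ρ ≤ v 0 ∧ ∀ m : ℕ, m < n → ((v ᵥ* PA φ) ᵥ* ((PB ρ φ) ^ m)) 0 < pi0 ρ) ↔
    (0 ≤ Emn ρ φ n n ∧ (n = 2 ∨ Emn ρ φ n (n - 2) < 0)) := by
  have hkey := key ρ φ hρ0 hρ1 n v hv hfix
  have hc0 := cc_pos ρ hρ0 hρ1
  have hc1 := cc_lt ρ hρ0 hρ1
  have hr : 0 < 1 - ρ := by linarith
  have hA : 0 < (1 + ρ) * (1 + ρ^2) := by positivity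
  have hT1 : 0 < 1 + (3*φ/2-1) * (e1 ρ φ)^n := by
    have := mul_nonneg (by linarith : 0 ≤ 3*φ/2-1) (hne.pow_nonneg (e1 ρ φ)); linarith
  have hT2 : 0 < 1 + (3*φ/2-1) * (e2 ρ φ)^n := by
    have := mul_nonneg (by linarith : 0 ≤ 3*φ/2-1) (hne.pow_nonneg (e2 ρ φ)); linarith
  have hpi : 0 < 3 * pi0 ρ - 1 := by
    have : 3 * pi0 ρ - 1 = (1-ρ)^2 / (2 * (1 + ρ + ρ^2)) := by unfold pi0; field_simp; ring
    rw [this]; positivity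
  have hF : 0 < 8 * cc ρ * (1 - ρ) * ((1 + ρ) * (1 + ρ^2)) * (1 + (3*φ/2-1) * (e1 ρ φ)^n)
      * (1 + (3*φ/2-1) * (e2 ρ φ)^n) := by positivity
  generalize 8 * cc ρ * (1 - ρ) * ((1 + ρ) * (1 + ρ^2)) * (1 + (3*φ/2-1) * (e1 ρ φ)^n)
      * (1 + (3*φ/2-1) * (e2 ρ φ)^n) = F at hkey hF
  have sgn : ∀ m : ℕ, ((v ᵥ* PA φ) ᵥ* ((PB ρ φ) ^ m)) 0 < pi0 ρ ↔ Emn ρ φ n m < 0 := by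
    intro m
    have k := hkey m
    constructor
    · intro h
      by_contra hc
      push Not at hc
      have := mul_nonneg hpi.le hc
      have := mul_pos hF (sub_pos.mpr h)
      linarith
    · intro h
      by_contra hc
      push Not at hc
      have := mul_nonneg hF.le (sub_nonneg.mpr hc)
      have := mul_pos hpi (neg_pos.mpr h)
      linarith
  have hvn : ((v ᵥ* PA φ) ᵥ* ((PB ρ φ) ^ n)) 0 = v 0 := by
    rw [Matrix.vecMul_vecMul, hfix]
  have sn : pi0 ρ ≤ v 0 ↔ 0 ≤ Emn ρ φ n n := by
    have := sgn n
    rw [hvn] at this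
    rw [← not_lt, this, not_lt]
  rw [sn]
  simp only [sgn]
  have hB : (1 - ρ) * Sv ρ = 2 * cc ρ * ((1 + ρ) * (1 + ρ^2)) := by
    unfold cc; field_simp
  obtain ⟨t, ht⟩ : ∃ t, t = 3*φ/2 - 1 := ⟨_, rfl⟩
  obtain ⟨u, hu⟩ : ∃ u, u = φ * cc ρ := ⟨_, rfl⟩
  have he1 : e1 ρ φ = u - t := by
    have : e1 ρ φ = 1 - φ + φ * (-(1/2) + cc ρ) := rfl
    rw [this, hu, ht]; ring
  have he2 : e2 ρ φ = -(t + u) := by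
    have : e2 ρ φ = 1 - φ + φ * (-(1/2) - cc ρ) := rfl
    rw [this, hu, ht]; ring
  have hu0 : 0 < u := by rw [hu]; exact mul_pos (by linarith) hc0
  have ht0 : 0 < t := by linarith
  have hu1 : u < t + 1 := by rw [hu, ht]; nlinarith
  have hE : ∀ m, Emn ρ φ n m = 4/3 * (1 - ρ) * ((1 + ρ) * (1 + ρ^2)) * (3/2) *
      ((1 + t * (e1 ρ φ)^n) * (t + 1 - u) * (e2 ρ φ)^m
        - (1 + t * (e2 ρ φ)^n) * (t + 1 + u) * (e1 ρ φ)^m) := by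
    intro m
    unfold Emn
    rw [hB, ht, hu]
    ring
  have hG : 0 < 4/3 * (1 - ρ) * ((1 + ρ) * (1 + ρ^2)) * (3/2) := by positivity
  generalize 4/3 * (1 - ρ) * ((1 + ρ) * (1 + ρ^2)) * (3/2) = G at hE hG
  have hEneg : ∀ m, Emn ρ φ n m < 0 ↔
      ((1 + t * (e1 ρ φ)^n) * (t + 1 - u) * (e2 ρ φ)^m
        - (1 + t * (e2 ρ φ)^n) * (t + 1 + u) * (e1 ρ φ)^m) < 0 := by
    intro m
    rw [hE m]
    constructor
    · intro h; by_contra hc; push Not at hc; have := mul_nonneg hG.le hc; linarith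
    · intro h; exact mul_neg_of_pos_of_neg hG h
  rw [← ht] at hT1 hT2
  have hsq : (e1 ρ φ)^2 ≤ (e2 ρ φ)^2 := by rw [he1, he2]; nlinarith [mul_pos ht0 hu0]
  have hx : e2 ρ φ < 0 := by rw [he2]; linarith
  have hα : 0 < (1 + t * (e1 ρ φ)^n) * (t + 1 - u) := mul_pos hT1 (by linarith)
  have hβ : 0 < (1 + t * (e2 ρ φ)^n) * (t + 1 + u) := mul_pos hT2 (by linarith)
  have hodd : (1 + t * (e1 ρ φ)^n) * (t + 1 - u) * (e2 ρ φ)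
        - (1 + t * (e2 ρ φ)^n) * (t + 1 + u) * (e1 ρ φ) < 0 := by
    rcases le_or_gt t u with h | h
    · have h1 : 0 ≤ e1 ρ φ := by rw [he1]; linarith
      have := mul_nonneg hβ.le h1
      have := mul_neg_of_pos_of_neg hα hx
      linarith
    · have := odd_key t u hu0 h (by linarith) n (by omega)
      have q1 : (e1 ρ φ)^n = (t-u)^n := by
        rw [he1, ← hne.neg_pow, neg_sub]
      have q2 : (e2 ρ φ)^n = (t+u)^n := by
        rw [he2, hne.neg_pow]
      rw [q1, q2, he1, he2]
      linarith
  have hzero : (1 + t * (e1 ρ φ)^n) * (t + 1 - u) < (1 + t * (e2 ρ φ)^n) * (t + 1 + u) := by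
    have hpw : (e1 ρ φ)^n ≤ (e2 ρ φ)^n := by
      obtain ⟨k, hk⟩ := hne
      rw [hk, ← two_mul, pow_mul, pow_mul]
      exact pow_le_pow_left₀ (sq_nonneg _) hsq k
    have h1 : (1 + t * (e1 ρ φ)^n) ≤ (1 + t * (e2 ρ φ)^n) := by
      have := mul_le_mul_of_nonneg_left hpw ht0.le; linarith
    have h2 : (1 + t * (e1 ρ φ)^n) * (t + 1 - u) < (1 + t * (e1 ρ φ)^n) * (t + 1 + u) :=
      mul_lt_mul_of_pos_left (by linarith) hT1
    have h3 := mul_le_mul_of_nonneg_right h1 (by linarith : 0 ≤ t + 1 + u)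
    linarith
  constructor
  · rintro ⟨h1, h2⟩
    exact ⟨h1, Or.inr (h2 (n-2) (by omega))⟩
  · rintro ⟨h1, h2⟩
    refine ⟨h1, fun m hm => ?_⟩
    rw [hEneg]
    rcases Nat.even_or_odd' m with ⟨j, rfl | rfl⟩
    · obtain ⟨k, hk⟩ := hne
      have hlast : (1 + t * (e1 ρ φ)^n) * (t + 1 - u) * (e2 ρ φ)^(n-2)
        - (1 + t * (e2 ρ φ)^n) * (t + 1 + u) * (e1 ρ φ)^(n-2) < 0 := by
        rcases h2 with h2 | h2
        · have : n - 2 = 0 := by omega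
          rw [this, pow_zero, pow_zero]
          linarith
        · exact (hEneg _).mp h2
      have hd : n - 2 = 2 * (j + (k - 1 - j)) := by omega
      rw [hd] at hlast
      exact stmt_even_case _ _ _ _ hα hβ hsq j _ hlast
    · exact stmt_odd_case _ _ _ _ hα hβ hx hsq hodd j
end

section
/- Assume 2/3 < φ ≤ 1, let n ≥ 4 be an even integer, and let v be a probability row vector (v ∈ Δ) satisfying v·(P_A·P_B^n·P_A·P_B^(n−2)) = v. Then the following are equivalent: (a) v₀ ≥ π₀, (v·P_A·P_B^m)₀ < π₀ for every 0 ≤ m ≤ n−1, (v·P_A·P_B^n)₀ ≥ π₀, and (v·P_A·P_B^n·P_A·P_B^m)₀ < π₀ for every 0 ≤ m ≤ n−3 (i.e., the greedy strategy started at v follows the periodic pattern [1,n,1,n−2]: one play of game A, n plays of game B, one play of game A, n−2 plays of game B, repeated forever); (b) G_{n,n−2} < 0 and H_{n,n−2} ≥ 0. -/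
open Matrix Filter

lemma my_mul_neg_left {a b : ℝ} (h : 0 < a) : a * b < 0 ↔ b < 0 :=
  ⟨fun h1 => (pos_iff_neg_of_mul_neg h1).1 h, fun h1 => mul_neg_of_pos_of_neg h h1⟩

lemma my_mul_neg_right {a b : ℝ} (h : 0 < b) : a * b < 0 ↔ a < 0 := by
  rw [mul_comm]; exact my_mul_neg_left h

lemma core_pow_diff (x y : ℝ) (hx : 0 ≤ x) (hxy : x ≤ y) (h1 : x + y ≤ 1) (k : ℕ) :
    y^(k+1) - x^(k+1) ≤ y - x := by
  induction k with
  | zero => simp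
  | succ k ih =>
    have h2 : x^(k+1) ≤ y^(k+1) := pow_le_pow_left₀ hx hxy _
    have h3 : x^k ≤ y^k := pow_le_pow_left₀ hx hxy _
    have h4 : y^(k+1+1) - x^(k+1+1) = (x+y)*(y^(k+1)-x^(k+1)) - x*y*(y^k-x^k) := by ring
    have h5 : 0 ≤ x*y*(y^k-x^k) :=
      mul_nonneg (mul_nonneg hx (hx.trans hxy)) (sub_nonneg.2 h3)
    nlinarith

lemma core_f (p q : ℝ) (hp : 0 ≤ p) (hpq : p ≤ q) (hq : q ≤ 1) (N : ℕ) :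
    q^(N+1)*(1-p) - p^(N+1)*(1-q) ≤ q - p := by
  induction N with
  | zero => simp; nlinarith
  | succ N ih =>
    have h2 : p^(N+1) ≤ q^(N+1) := pow_le_pow_left₀ hp hpq _
    have h4 : 0 ≤ (1-p)*(1-q)*(q^(N+1) - p^(N+1)) :=
      mul_nonneg (mul_nonneg (by linarith) (by linarith)) (sub_nonneg.2 h2)
    have h5 : q^(N+1+1)*(1-p) - p^(N+1+1)*(1-q)
      = q^(N+1)*(1-p) - p^(N+1)*(1-q) - (1-p)*(1-q)*(q^(N+1) - p^(N+1)) := by ring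
    linarith

noncomputable def gg (a b c : ℝ) (n j m : ℕ) : ℝ :=
  b^m * (4 - a^(2*(n-1))*c^2) * (2 - b^j*c) * (1-a)
   - a^m * (4 - b^(2*(n-1))*c^2) * (2 - a^j*c) * (1-b)

set_option maxHeartbeats 1000000 in
lemma core (a b c : ℝ) (hc0 : 0 < c) (hc1 : c ≤ 1) (hsum : a + b = -c) (hab : b < a)
    (hb : -1 < b) (ha : a < 1) (k : ℕ)
    (hG : gg a b c (2*k+4) (2*k+2) (2*k+2) < 0) (hH : 0 ≤ gg a b c (2*k+4) (2*k+4) (2*k+2)) :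
    (∀ m : ℕ, m < 2*k+4 → gg a b c (2*k+4) (2*k+2) m < 0) ∧
    0 ≤ gg a b c (2*k+4) (2*k+2) (2*k+4) ∧
    (∀ m : ℕ, m ≤ 2*k+1 → gg a b c (2*k+4) (2*k+4) m < 0) := by
  have hb0 : b < 0 := by linarith
  have hpq : a^2 < b^2 := by nlinarith
  have hq : b^2 < 1 := by nlinarith
  have hp0 : 0 ≤ a^2 := sq_nonneg a
  have hq0 : 0 < b^2 := by nlinarith
  have hac : ∀ i, (a^2)^i * c ≤ 1 := fun i => by
    have : (a^2)^i ≤ 1 := pow_le_one₀ hp0 (by linarith)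
    have : 0 ≤ (a^2)^i := by positivity
    nlinarith
  have hbc : ∀ i, (b^2)^i * c ≤ 1 := fun i => by
    have : (b^2)^i ≤ 1 := pow_le_one₀ hq0.le (by linarith)
    have : 0 ≤ (b^2)^i := by positivity
    nlinarith
  have hc2 : c^2 ≤ 1 := by nlinarith
  have hcc : 0 < c^2 := by positivity
  have hC2 : 0 < 4 - (a^2)^(2*k+3)*c^2 := by
    have : (a^2)^(2*k+3) ≤ 1 := pow_le_one₀ hp0 (by linarith)
    nlinarith
  have hC1 : 0 < 4 - (b^2)^(2*k+3)*c^2 := by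
    have : (b^2)^(2*k+3) ≤ 1 := pow_le_one₀ hq0.le (by linarith)
    nlinarith
  have hC12 : 4 - (b^2)^(2*k+3)*c^2 ≤ 4 - (a^2)^(2*k+3)*c^2 := by
    have : (a^2)^(2*k+3) ≤ (b^2)^(2*k+3) := pow_le_pow_left₀ hp0 hpq.le _
    nlinarith
  have key : ∀ j m, gg a b c (2*k+4) (2*j) m =
      b^m * ((4 - (a^2)^(2*k+3)*c^2) * (2 - (b^2)^j*c) * (1-a))
      - a^m * ((4 - (b^2)^(2*k+3)*c^2) * (2 - (a^2)^j*c) * (1-b)) := by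
    intro j m
    unfold gg
    rw [show 2*k+4-1 = 2*k+3 by omega]
    simp only [pow_mul]
    ring_nf
  have e2 : 2*k+2 = 2*(k+1) := by ring
  have e4 : 2*k+4 = 2*(k+2) := by ring
  have G : ∀ m, gg a b c (2*k+4) (2*k+2) m = _ := fun m => e2 ▸ key (k+1) m
  have H : ∀ m, gg a b c (2*k+4) (2*k+4) m =
      b^m * ((4 - (a^2)^(2*k+3)*c^2) * (2 - (b^2)^(k+2)*c) * (1-a))
      - a^m * ((4 - (b^2)^(2*k+3)*c^2) * (2 - (a^2)^(k+2)*c) * (1-b)) := fun m => by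
    have := key (k+2) m
    rw [show 2*(k+2) = 2*k+4 by ring] at this
    exact this
  have hX : 0 < (4 - (a^2)^(2*k+3)*c^2) * (2 - (b^2)^(k+1)*c) * (1-a) :=
    mul_pos (mul_pos hC2 (by linarith [hbc (k+1)])) (by linarith)
  have hY : 0 < (4 - (b^2)^(2*k+3)*c^2) * (2 - (a^2)^(k+1)*c) * (1-b) :=
    mul_pos (mul_pos hC1 (by linarith [hac (k+1)])) (by linarith)
  have hX' : 0 < (4 - (a^2)^(2*k+3)*c^2) * (2 - (b^2)^(k+2)*c) * (1-a) :=
    mul_pos (mul_pos hC2 (by linarith [hbc (k+2)])) (by linarith)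
  have hY' : 0 < (4 - (b^2)^(2*k+3)*c^2) * (2 - (a^2)^(k+2)*c) * (1-b) :=
    mul_pos (mul_pos hC1 (by linarith [hac (k+2)])) (by linarith)
  have hI : a^2 * (((4 - (a^2)^(2*k+3)*c^2) * (2 - (b^2)^(k+2)*c) * (1-a)) *
        ((4 - (b^2)^(2*k+3)*c^2) * (2 - (a^2)^(k+1)*c) * (1-b))) ≤
      b^2 * (((4 - (a^2)^(2*k+3)*c^2) * (2 - (b^2)^(k+1)*c) * (1-a)) *
        ((4 - (b^2)^(2*k+3)*c^2) * (2 - (a^2)^(k+2)*c) * (1-b))) := by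
    have h1 := core_f (a^2) (b^2) hp0 hpq.le hq.le (k+1)
    have h2 : a^2 * ((2 - (b^2)^(k+2)*c) * (2 - (a^2)^(k+1)*c)) ≤
        b^2 * ((2 - (b^2)^(k+1)*c) * (2 - (a^2)^(k+2)*c)) := by
      have h3 : b^2 * ((2 - (b^2)^(k+1)*c) * (2 - (a^2)^(k+2)*c)) -
        a^2 * ((2 - (b^2)^(k+2)*c) * (2 - (a^2)^(k+1)*c)) =
        2*(2*(b^2-a^2) - c*((b^2)^(k+1+1)*(1-a^2) - (a^2)^(k+1+1)*(1-b^2))) := by ring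
      have h4 : c*((b^2)^(k+1+1)*(1-a^2) - (a^2)^(k+1+1)*(1-b^2)) ≤ c*(b^2-a^2) :=
        mul_le_mul_of_nonneg_left h1 hc0.le
      nlinarith
    have h5 : 0 ≤ (4 - (a^2)^(2*k+3)*c^2) * (1-a) * ((4 - (b^2)^(2*k+3)*c^2)* (1-b)) :=
      mul_nonneg (mul_nonneg hC2.le (by linarith)) (mul_nonneg hC1.le (by linarith))
    have := mul_le_mul_of_nonneg_left h2 h5
    calc _ = _ := by ring
      _ ≤ _ := this
      _ = _ := by ring
  have ha0 : 0 ≤ a := by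
    by_contra hneg
    push Not at hneg
    have h1 := core_pow_diff (-a) (-b) (by linarith) (by linarith) (by linarith) (2*k+2)
    have h2 : (-a) * (2 - (a^2)^(k+1)*c) ≤ (-b) * (2 - (b^2)^(k+1)*c) := by
      have e : ∀ z : ℝ, (-z) * (2 - (z^2)^(k+1)*c) = 2*(-z) - c*(-z)^(2*k+2+1) := by
        intro z
        have : (-z)^(2*k+2+1) = (z^2)^(k+1) * (-z) := by
          rw [pow_succ (-z), show 2*k+2 = 2*(k+1) by ring, pow_mul, neg_sq]
        rw [this]; ring
      rw [e, e]
      have h8 := mul_le_mul_of_nonneg_left h1 hc0.le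
      have h9 : c * (-b - -a) ≤ 1 * (-b - -a) :=
        mul_le_mul_of_nonneg_right hc1 (by linarith)
      linarith
    have h3 : (-a)*(1-b) ≤ (-b)*(1-a) := by linarith [mul_comm a b]
    have h4 : ((-a) * (2 - (a^2)^(k+1)*c)) * ((-a)*(1-b)) ≤
        ((-b) * (2 - (b^2)^(k+1)*c)) * ((-b)*(1-a)) :=
      mul_le_mul h2 h3 (mul_nonneg (by linarith) (by linarith))
        (mul_nonneg (by linarith) (by linarith [hbc (k+1)]))
    have h5 : (4 - (b^2)^(2*k+3)*c^2) * (((-a) * (2 - (a^2)^(k+1)*c)) * ((-a)*(1-b))) ≤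
        (4 - (a^2)^(2*k+3)*c^2) * (((-b) * (2 - (b^2)^(k+1)*c)) * ((-b)*(1-a))) :=
      mul_le_mul hC12 h4 (mul_nonneg (mul_nonneg (by linarith) (by linarith [hac (k+1)]))
        (mul_nonneg (by linarith) (by linarith))) hC2.le
    have h6 : (a^2)^k ≤ (b^2)^k := pow_le_pow_left₀ hp0 hpq.le _
    have h7 := mul_le_mul h6 h5 (mul_nonneg hC1.le (mul_nonneg
      (mul_nonneg (by linarith) (by linarith [hac (k+1)]))
        (mul_nonneg (by linarith) (by linarith)))) (by positivity)
    rw [G] at hG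
    have e : ∀ z : ℝ, z^(2*k+2) = (z^2)^k*z^2 := by intro z; rw [pow_add, pow_mul]
    rw [e, e] at hG
    linarith
  rw [G] at hG
  rw [H] at hH
  generalize (4 - (a^2)^(2*k+3)*c^2) * (2 - (b^2)^(k+1)*c) * (1-a) = X at *
  generalize (4 - (b^2)^(2*k+3)*c^2) * (2 - (a^2)^(k+1)*c) * (1-b) = Y at *
  generalize (4 - (a^2)^(2*k+3)*c^2) * (2 - (b^2)^(k+2)*c) * (1-a) = X' at *
  generalize (4 - (b^2)^(2*k+3)*c^2) * (2 - (a^2)^(k+2)*c) * (1-b) = Y' at *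
  have hodd : ∀ (m : ℕ) (X Y : ℝ), Odd m → 0 < X → 0 < Y → b^m * X - a^m * Y < 0 := by
    intro m X Y hm hX hY
    have h1 : b^m < 0 := hm.pow_neg hb0
    have h2 : 0 ≤ a^m := pow_nonneg ha0 _
    nlinarith [mul_pos_of_neg_of_neg h1 (neg_neg_of_pos hX), mul_nonneg h2 hY.le]
  have hdesc : ∀ (i m : ℕ) (X Y : ℝ), 0 < Y →
      (b^2)^(m+i) * X - (a^2)^(m+i) * Y < 0 → (b^2)^m * X - (a^2)^m * Y < 0 := by
    intro i m X Y hY h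
    rw [pow_add, pow_add] at h
    have h6 : (a^2)^i ≤ (b^2)^i := pow_le_pow_left₀ hp0 hpq.le _
    have h7 : 0 < (b^2)^i := by positivity
    have h8 : (a^2)^m * Y * (a^2)^i ≤ (a^2)^m * Y * (b^2)^i :=
      mul_le_mul_of_nonneg_left h6 (by positivity)
    have h9 : (b^2)^i * ((b^2)^m * X - (a^2)^m * Y) < 0 := by nlinarith
    exact (pos_iff_neg_of_mul_neg h9).1 h7
  have hGe : (b^2)^(k+1) * X - (a^2)^(k+1) * Y < 0 := by
    rw [← pow_mul, ← pow_mul]; exact hG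
  have hHe : 0 ≤ (b^2)^(k+1) * X' - (a^2)^(k+1) * Y' := by
    rw [← pow_mul, ← pow_mul]; exact hH
  refine ⟨?_, ?_, ?_⟩
  · intro m hm
    rw [G]
    rcases Nat.even_or_odd m with he | ho
    · obtain ⟨j, rfl⟩ := he
      rw [← two_mul, pow_mul, pow_mul]
      apply hdesc (k+1-j) j X Y hY
      rw [show j + (k+1-j) = k+1 by omega]; exact hGe
    · exact hodd m _ _ ho hX hY
  · rw [G, e4, pow_mul, pow_mul]
    have h1 := mul_nonneg hHe (mul_nonneg hp0 hY.le)
    have h2 := mul_le_mul_of_nonneg_left hI (pow_nonneg hq0.le (k+1))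
    have h3 : 0 ≤ ((b^2)^(k+2) * X - (a^2)^(k+2) * Y) * Y' := by
      rw [pow_succ (b^2), pow_succ (a^2)]
      nlinarith
    exact nonneg_of_mul_nonneg_left h3 hY'
  · intro m hm
    rw [H]
    rcases Nat.even_or_odd m with he | ho
    · obtain ⟨j, rfl⟩ := he
      rw [← two_mul, pow_mul, pow_mul]
      apply hdesc (k-j) j X' Y' hY'
      rw [show j + (k-j) = k by omega]
      have h1 := mul_neg_of_neg_of_pos hGe hX'
      have h2 := mul_le_mul_of_nonneg_left hI (pow_nonneg hp0 k)
      have h3 : (b^2 * X) * ((b^2)^k * X' - (a^2)^k * Y') < 0 := by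
        rw [pow_succ (b^2), pow_succ (a^2)] at h1
        nlinarith
      exact (pos_iff_neg_of_mul_neg h3).1 (by positivity)
    · exact hodd m _ _ ho hX' hY'

lemma eig_facts (ρ φ : ℝ) (hρ0 : 0 < ρ) (hρ1 : ρ < 1) (hφ0 : 2/3 < φ) (hφ1 : φ ≤ 1) :
    e1 ρ φ + e2 ρ φ = -(3*φ-2) ∧ e2 ρ φ < e1 ρ φ ∧ -1 < e2 ρ φ ∧ e1 ρ φ < 1 ∧
    e1 ρ φ * e2 ρ φ = (1-3*φ/2)^2
      - φ^2 * ((1-ρ)^2*(1+4*ρ+ρ^2)/(4*(1+ρ)^2*(1+ρ^2))) ∧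
    3*(1+ρ)*(1+ρ^2) - (1-ρ) * Sv ρ = 2/φ*((1+ρ)*(1+ρ^2))*(1 - e1 ρ φ) ∧
    3*(1+ρ)*(1+ρ^2) + (1-ρ) * Sv ρ = 2/φ*((1+ρ)*(1+ρ^2))*(1 - e2 ρ φ) := by
  have hS2 : Sv ρ ^ 2 = (1 + ρ^2) * (1 + 4*ρ + ρ^2) := Real.sq_sqrt (by positivity)
  have hS : 0 < Sv ρ := Real.sqrt_pos.2 (by positivity)
  have h1 : 0 < 1 - ρ := by linarith
  obtain ⟨s, hs⟩ : ∃ s, s = (1 - ρ) * Sv ρ / (2 * (1 + ρ) * (1 + ρ^2)) := ⟨_, rfl⟩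
  have hs0 : 0 < s := by rw [hs]; positivity
  have hs2 : s^2 = (1-ρ)^2*(1+4*ρ+ρ^2)/(4*(1+ρ)^2*(1+ρ^2)) := by
    rw [hs, div_pow, mul_pow, hS2]; field_simp; ring
  have hs3 : s < 1/2 := by
    have : s^2 < 1/4 := by
      rw [hs2, div_lt_div_iff₀ (by positivity) (by norm_num)]
      nlinarith [sq_pos_of_pos hρ0]
    nlinarith
  have hs4 : (1-ρ)*Sv ρ = s * (2 * (1 + ρ) * (1 + ρ^2)) := by rw [hs]; field_simp
  have hφ : 0 < φ := by linarith
  unfold e1 e2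
  rw [← hs, ← hs2, hs4]
  refine ⟨by ring, ?_, ?_, ?_, by ring, ?_, ?_⟩
  · nlinarith
  · nlinarith
  · nlinarith
  · field_simp; ring
  · field_simp; ring

noncomputable def L (ρ φ e : ℝ) (x : Fin 3 → ℝ) : ℝ :=
  (x ᵥ* PB ρ φ) 0 - e * x 0 - (1 - e) * pi0 ρ

lemma PB_app (ρ φ : ℝ) (x : Fin 3 → ℝ) :
    (x ᵥ* PB ρ φ) 0 = (1-φ) * x 0 + φ * (x 1 * (1 - 1/(1+ρ)) + x 2 * (1/(1+ρ))) ∧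
    (x ᵥ* PB ρ φ) 1 = (1-φ) * x 1 + φ * (x 0 * (ρ^2/(1+ρ^2)) + x 2 * (1 - 1/(1+ρ))) ∧
    (x ᵥ* PB ρ φ) 2 = (1-φ) * x 2 + φ * (x 0 * (1 - ρ^2/(1+ρ^2)) + x 1 * (1/(1+ρ))) := by
  refine ⟨?_, ?_, ?_⟩ <;>
  simp [PB, PBo, Matrix.vecMul, dotProduct, Fin.sum_univ_three, Matrix.add_apply,
    Matrix.smul_apply, Matrix.one_apply] <;> ring

lemma PA_app (φ : ℝ) (x : Fin 3 → ℝ) :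
    (x ᵥ* PA φ) 0 = (1-φ) * x 0 + φ * (x 1 / 2 + x 2 / 2) ∧
    (x ᵥ* PA φ) 1 = (1-φ) * x 1 + φ * (x 0 / 2 + x 2 / 2) ∧
    (x ᵥ* PA φ) 2 = (1-φ) * x 2 + φ * (x 0 / 2 + x 1 / 2) := by
  refine ⟨?_, ?_, ?_⟩ <;>
  simp [PA, PAo, Matrix.vecMul, dotProduct, Fin.sum_univ_three, Matrix.add_apply,
    Matrix.smul_apply, Matrix.one_apply] <;> ring

def Sum1 (x : Fin 3 → ℝ) : Prop := x 0 + x 1 + x 2 = 1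

lemma sum_PB (ρ φ : ℝ) (x : Fin 3 → ℝ) (h : Sum1 x) : Sum1 (x ᵥ* PB ρ φ) := by
  obtain ⟨h0, h1, h2⟩ := PB_app ρ φ x
  unfold Sum1 at *
  rw [h0, h1, h2]; linear_combination h

lemma sum_PA (φ : ℝ) (x : Fin 3 → ℝ) (h : Sum1 x) : Sum1 (x ᵥ* PA φ) := by
  obtain ⟨h0, h1, h2⟩ := PA_app φ x
  unfold Sum1 at *
  rw [h0, h1, h2]; linear_combination h

lemma L_PB (ρ φ a b : ℝ) (hρ : 0 < ρ) (hsum : a + b = -(3*φ-2))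
    (hprod : a * b = (1-3*φ/2)^2 - φ^2 * ((1-ρ)^2*(1+4*ρ+ρ^2)/(4*(1+ρ)^2*(1+ρ^2))))
    (x : Fin 3 → ℝ) (h : Sum1 x) : L ρ φ b (x ᵥ* PB ρ φ) = a * L ρ φ b x := by
  have key : ((x ᵥ* PB ρ φ) ᵥ* PB ρ φ) 0 - (-(3*φ-2)) * (x ᵥ* PB ρ φ) 0
      + ((1-3*φ/2)^2 - φ^2 * ((1-ρ)^2*(1+4*ρ+ρ^2)/(4*(1+ρ)^2*(1+ρ^2)))) * x 0
      - (1 + (3*φ-2) + ((1-3*φ/2)^2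
        - φ^2 * ((1-ρ)^2*(1+4*ρ+ρ^2)/(4*(1+ρ)^2*(1+ρ^2))))) * pi0 ρ = 0 := by
    obtain ⟨h0, h1, h2⟩ := PB_app ρ φ x
    rw [(PB_app ρ φ (x ᵥ* PB ρ φ)).1, h0, h1, h2]
    have hx : x 2 = 1 - x 0 - x 1 := by unfold Sum1 at h; linarith
    rw [hx]
    unfold pi0
    field_simp
    ring
  rw [← hsum, ← hprod] at key
  unfold L
  linear_combination key + pi0 ρ * hsum

lemma L_PA (ρ φ e : ℝ) (hρ : 0 < ρ) (x : Fin 3 → ℝ) (h : Sum1 x) :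
    L ρ φ e (x ᵥ* PA φ) = (1-3*φ/2) * L ρ φ e x
      - (3*φ/2*(pi0 ρ - 1/3)) * (1 - e) := by
  obtain ⟨h0, h1, h2⟩ := PA_app φ x
  unfold L
  rw [(PB_app ρ φ (x ᵥ* PA φ)).1, (PB_app ρ φ x).1, h0, h1, h2]
  have hx : x 2 = 1 - x 0 - x 1 := by unfold Sum1 at h; linarith
  rw [hx]
  field_simp
  ring

lemma L_PB_pow (ρ φ a b : ℝ) (hρ : 0 < ρ) (hsum : a + b = -(3*φ-2))
    (hprod : a * b = (1-3*φ/2)^2 - φ^2 * ((1-ρ)^2*(1+4*ρ+ρ^2)/(4*(1+ρ)^2*(1+ρ^2))))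
    (x : Fin 3 → ℝ) (h : Sum1 x) (m : ℕ) :
    Sum1 (x ᵥ* (PB ρ φ)^m) ∧ L ρ φ b (x ᵥ* (PB ρ φ)^m) = a^m * L ρ φ b x := by
  induction m with
  | zero => simpa using h
  | succ m ih =>
    rw [pow_succ, ← Matrix.vecMul_vecMul]
    refine ⟨sum_PB _ _ _ ih.1, ?_⟩
    rw [L_PB ρ φ a b hρ hsum hprod _ ih.1, ih.2]; ring

lemma scal (w a b c A p q A' : ℝ) (h : A' = -(c/2) * A - w*(1-b))
    (hA : A = p * (-(c/2) * (q * A') - w*(1-b))) :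
    A' * (4 - p*q*c^2) = -2*w*(1-b)*(2 - p*c) ∧
    (-(c/2) * (q * A') - w*(1-b)) * (4 - p*q*c^2) = -2*w*(1-b)*(2 - q*c) := by
  have : A' * (4 - p*q*c^2) = -2*w*(1-b)*(2 - p*c) := by
    linear_combination 4 * h + (-2*c) * hA
  refine ⟨this, ?_⟩
  linear_combination (-(c/2)*q) * this

set_option maxHeartbeats 1000000 in
theorem stmt_15 (ρ φ : ℝ) (hρ0 : 0 < ρ) (hρ1 : ρ < 1) (hφ0 : 2/3 < φ) (hφ1 : φ ≤ 1)
    (n : ℕ) (hn : 4 ≤ n) (hne : Even n) (v : Fin 3 → ℝ) (hv : v ∈ Δ)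
    (hfix : v ᵥ* (PA φ * (PB ρ φ) ^ n * PA φ * (PB ρ φ) ^ (n - 2)) = v) :
    (pi0 ρ ≤ v 0 ∧
      (∀ m : ℕ, m < n → ((v ᵥ* PA φ) ᵥ* ((PB ρ φ) ^ m)) 0 < pi0 ρ) ∧
      pi0 ρ ≤ ((v ᵥ* PA φ) ᵥ* ((PB ρ φ) ^ n)) 0 ∧
      (∀ m : ℕ, m ≤ n - 3 →
        ((((v ᵥ* PA φ) ᵥ* ((PB ρ φ) ^ n)) ᵥ* PA φ) ᵥ* ((PB ρ φ) ^ m)) 0 < pi0 ρ)) ↔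
    (Gmn ρ φ n (n - 2) < 0 ∧ 0 ≤ Hmn ρ φ n (n - 2)) := by
  obtain ⟨k, rfl⟩ : ∃ k, n = 2*k+4 := by
    obtain ⟨r, rfl⟩ := hne
    exact ⟨r-2, by omega⟩
  obtain ⟨hsum, hlt, hb, ha, hprod, hK2, hK1⟩ := eig_facts ρ φ hρ0 hρ1 hφ0 hφ1
  have hsum' : e2 ρ φ + e1 ρ φ = -(3*φ-2) := by linarith
  have hprod' := hprod
  rw [mul_comm] at hprod'
  have hφ : 0 < φ := by linarith
  have hc0 : 0 < 3*φ-2 := by linarith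
  have hc1 : 3*φ-2 ≤ 1 := by linarith
  have hden : ∀ e : ℝ, e^2 ≤ 1 → 0 < 4 - e^(2*(2*k+4-1))*(3*φ-2)^2 := by
    intro e he
    have h1 : e^(2*(2*k+4-1)) ≤ 1 := by rw [pow_mul]; exact pow_le_one₀ (sq_nonneg e) he
    have h2 : 0 < (3*φ-2)^2 := by positivity
    have h3 : (3*φ-2)^2 ≤ 1 := by nlinarith
    nlinarith
  have hD1 := hden (e1 ρ φ) ((sq_le_one_iff_abs_le_one _).2 (abs_le.2 ⟨by linarith, by linarith⟩))
  have hD2 := hden (e2 ρ φ) ((sq_le_one_iff_abs_le_one _).2 (abs_le.2 ⟨by linarith, by linarith⟩))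
  have hM : 0 < (e1 ρ φ - e2 ρ φ) * ((4 - (e1 ρ φ)^(2*(2*k+4-1))*(3*φ-2)^2) *
      (4 - (e2 ρ φ)^(2*(2*k+4-1))*(3*φ-2)^2)) :=
    mul_pos (by linarith) (mul_pos hD1 hD2)
  have hw : 0 < 3*φ/2*(pi0 ρ - 1/3) := by
    have : pi0 ρ - 1/3 = (1-ρ)^2/(6*(1+ρ+ρ^2)) := by unfold pi0; field_simp; ring
    rw [this]
    have : 0 < 1 - ρ := by linarith
    positivity
  have hκ : 0 < 2*(1-ρ)*((1+ρ)*(1+ρ^2)) := by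
    have : 0 < 1 - ρ := by linarith
    positivity
  have hGm : ∀ m, Gmn ρ φ (2*k+4) m =
      2*(1-ρ)*((1+ρ)*(1+ρ^2)) * gg (e1 ρ φ) (e2 ρ φ) (3*φ-2) (2*k+4) (2*k+2) m := by
    intro m
    unfold Gmn gg
    rw [hK1, hK2, show 2*k+4-2 = 2*k+2 by omega]
    field_simp
  have hHm : ∀ m, Hmn ρ φ (2*k+4) m =
      2*(1-ρ)*((1+ρ)*(1+ρ^2)) * gg (e1 ρ φ) (e2 ρ φ) (3*φ-2) (2*k+4) (2*k+4) m := by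
    intro m
    unfold Hmn gg
    rw [hK1, hK2]
    field_simp
  have hL : ∀ x, L ρ φ (e2 ρ φ) x - L ρ φ (e1 ρ φ) x
      = (e1 ρ φ - e2 ρ φ) * (x 0 - pi0 ρ) := by
    intro x; unfold L; ring
  have P1 := L_PB_pow ρ φ (e1 ρ φ) (e2 ρ φ) hρ0 hsum hprod
  have P2 := L_PB_pow ρ φ (e2 ρ φ) (e1 ρ φ) hρ0 hsum' hprod'
  have hv1 : Sum1 v := hv.2
  have hy : Sum1 (v ᵥ* PA φ) := sum_PA _ _ hv1
  have hyn := (P1 _ hy (2*k+4)).1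
  have hz : Sum1 (((v ᵥ* PA φ) ᵥ* ((PB ρ φ) ^ (2*k+4))) ᵥ* PA φ) := sum_PA _ _ hyn
  have hfix' : (((v ᵥ* PA φ) ᵥ* ((PB ρ φ) ^ (2*k+4))) ᵥ* PA φ) ᵥ* (PB ρ φ)^(2*k+2) = v := by
    rw [show 2*k+4-2 = 2*k+2 by omega] at hfix
    simpa [Matrix.vecMul_vecMul, Matrix.mul_assoc] using hfix
  have hc : (1 - 3*φ/2) = -((3*φ-2)/2) := by ring
  have A1 := L_PA ρ φ (e2 ρ φ) hρ0 v hv1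
  have A2 := L_PA ρ φ (e1 ρ φ) hρ0 v hv1
  have B1 := L_PA ρ φ (e2 ρ φ) hρ0 _ hyn
  have B2 := L_PA ρ φ (e1 ρ φ) hρ0 _ hyn
  rw [(P1 _ hy (2*k+4)).2] at B1
  rw [(P2 _ hy (2*k+4)).2] at B2
  have F1 := (P1 _ hz (2*k+2)).2
  have F2 := (P2 _ hz (2*k+2)).2
  rw [hfix'] at F1 F2
  rw [hc] at A1 A2 B1 B2
  have F1' := F1
  have F2' := F2
  rw [B1] at F1'
  rw [B2] at F2'
  obtain ⟨S1, T1⟩ := scal _ (e1 ρ φ) _ _ _ _ _ _ A1 F1'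
  obtain ⟨S2, T2⟩ := scal _ (e2 ρ φ) _ _ _ _ _ _ A2 F2'
  rw [← B1] at T1
  rw [← B2] at T2
  have hpw : ∀ e : ℝ, e^(2*k+2) * e^(2*k+4) = e^(2*(2*k+4-1)) := by
    intro e; rw [← pow_add]; congr 1; omega
  rw [hpw] at S1 S2 T1 T2
  have Gy : ∀ m, (((v ᵥ* PA φ) ᵥ* ((PB ρ φ) ^ m)) 0 - pi0 ρ) *
      ((e1 ρ φ - e2 ρ φ) * ((4 - (e1 ρ φ)^(2*(2*k+4-1))*(3*φ-2)^2) *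
      (4 - (e2 ρ φ)^(2*(2*k+4-1))*(3*φ-2)^2))) =
      2*(3*φ/2*(pi0 ρ - 1/3)) * gg (e1 ρ φ) (e2 ρ φ) (3*φ-2) (2*k+4) (2*k+2) m := by
    intro m
    have h := hL ((v ᵥ* PA φ) ᵥ* ((PB ρ φ) ^ m))
    rw [(P1 _ hy m).2, (P2 _ hy m).2] at h
    unfold gg
    linear_combination (-((4 - (e1 ρ φ)^(2*(2*k+4-1))*(3*φ-2)^2) *
      (4 - (e2 ρ φ)^(2*(2*k+4-1))*(3*φ-2)^2))) * h
      + (e1 ρ φ)^m * (4 - (e2 ρ φ)^(2*(2*k+4-1))*(3*φ-2)^2) * S1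
      - (e2 ρ φ)^m * (4 - (e1 ρ φ)^(2*(2*k+4-1))*(3*φ-2)^2) * S2
  have Hz : ∀ m, (((((v ᵥ* PA φ) ᵥ* ((PB ρ φ) ^ (2*k+4))) ᵥ* PA φ) ᵥ* ((PB ρ φ) ^ m)) 0
        - pi0 ρ) *
      ((e1 ρ φ - e2 ρ φ) * ((4 - (e1 ρ φ)^(2*(2*k+4-1))*(3*φ-2)^2) *
      (4 - (e2 ρ φ)^(2*(2*k+4-1))*(3*φ-2)^2))) =
      2*(3*φ/2*(pi0 ρ - 1/3)) * gg (e1 ρ φ) (e2 ρ φ) (3*φ-2) (2*k+4) (2*k+4) m := by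
    intro m
    have h := hL ((((v ᵥ* PA φ) ᵥ* ((PB ρ φ) ^ (2*k+4))) ᵥ* PA φ) ᵥ* ((PB ρ φ) ^ m))
    rw [(P1 _ hz m).2, (P2 _ hz m).2] at h
    unfold gg
    linear_combination (-((4 - (e1 ρ φ)^(2*(2*k+4-1))*(3*φ-2)^2) *
      (4 - (e2 ρ φ)^(2*(2*k+4-1))*(3*φ-2)^2))) * h
      + (e1 ρ φ)^m * (4 - (e2 ρ φ)^(2*(2*k+4-1))*(3*φ-2)^2) * T1
      - (e2 ρ φ)^m * (4 - (e1 ρ φ)^(2*(2*k+4-1))*(3*φ-2)^2) * T2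
  have sgn : ∀ t M W g : ℝ, 0 < M → 0 < W → (t - pi0 ρ) * M = W * g →
      ((t < pi0 ρ ↔ g < 0) ∧ (pi0 ρ ≤ t ↔ 0 ≤ g)) := by
    intro t M W g hM hW h
    have key : t < pi0 ρ ↔ g < 0 := by
      rw [← sub_neg, ← my_mul_neg_right hM, h, my_mul_neg_left hW]
    exact ⟨key, by rw [← not_lt, ← not_lt, key]⟩
  have hW : 0 < 2*(3*φ/2*(pi0 ρ - 1/3)) := by linarith
  have sG := fun m => sgn _ _ _ _ hM hW (Gy m)
  have sH := fun m => sgn _ _ _ _ hM hW (Hz m)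
  have sv := (sH (2*k+2)).2
  rw [hfix'] at sv
  rw [hGm, hHm, my_mul_neg_left hκ, mul_nonneg_iff_of_pos_left hκ, sv,
    show 2*k+4-2 = 2*k+2 by omega, show 2*k+4-3 = 2*k+1 by omega]
  constructor
  · rintro ⟨h1, h2, -, -⟩
    exact ⟨(sG _).1.1 (h2 _ (by omega)), h1⟩
  · rintro ⟨hG, hH⟩
    obtain ⟨c1, c2, c3⟩ := core _ _ _ hc0 hc1 hsum hlt hb ha k hG hH
    exact ⟨hH, fun m hm => (sG m).1.2 (c1 m hm), (sG _).2.2 c2,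
      fun m hm => (sH m).1.2 (c3 m hm)⟩
end
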